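/- Let S1 and S2 be path covers of G with 𝒫(S1) = {Q1, …, Qk, P1} and 𝒫(S2) = {Q1, …, Qk, P2}, where k ≥ 1, each Q_i is an (x_i, y_i)-path (the Q_i are common to both path covers and pairwise vertex-disjoint), P1 is a (p1, p2)-path, P2 is a (p3, p4)-path, V(P1) = V(P2), p1 ∉ {p3, p4} and p4 ∉ {p1, p2} (the case p2 = p3 is allowed). Then there exist edge sets A1, A2 ⊆ E with A1 ∩ A2 = ∅ such that: (i) S_i ∪ A_i is a tour of G for i = 1,2; (ii) V(A_i) = V1(S_i) for i = 1,2; and (iii) A1 ∪ A2 consists of a (p1, p4)-path if p2 = p3, of vertex-disjoint (p1, p3)- and (p2, p4)-paths if p2 ≠ p3 and k is odd, and of vertex-disjoint (p1, p2)- and (p3, p4)-paths if p2 ≠ p3 and k is even. Moreover, for any prescribed labeling (x1, y1) of the two endpoints of Q1, the sets A1 and A2 can be chosen so that (p2, x1) ∈ A1 and (p3, y1) ∈ A2. -/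

import Mathlib

variable {V : Type*} [Fintype V] [DecidableEq V]

/-- The degree of vertex `v` in the edge set `F`. -/
def degE (F : Finset (Sym2 V)) (v : V) : ℕ := (F.filter (fun e => v ∈ e)).card

/-- The set of vertices incident to an edge of `F`. -/
def VsetE (F : Finset (Sym2 V)) : Set V := {v | ∃ e ∈ F, v ∈ e}

/-- Vertices incident to exactly one edge of `F`. -/
def V1E (F : Finset (Sym2 V)) : Set V := {v | degE F v = 1}

/-- Vertices incident to exactly two edges of `F`. -/
def V2E (F : Finset (Sym2 V)) : Set V := {v | degE F v = 2}

/-- All edges are genuine edges of the complete graph (no loops). -/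
def SimpleE (F : Finset (Sym2 V)) : Prop := ∀ e ∈ F, ¬ e.IsDiag

/-- `F` is spanning: every vertex is incident to an edge of `F`. -/
def SpanningE (F : Finset (Sym2 V)) : Prop := VsetE F = Set.univ

/-- `F` is a `k`-matching: every vertex has at most `k` incident edges. -/
def IsKMatching (k : ℕ) (F : Finset (Sym2 V)) : Prop :=
  SimpleE F ∧ ∀ v : V, degE F v ≤ k

/-- `F` is a `k`-factor: every vertex has exactly `k` incident edges. -/
def IsKFactor (k : ℕ) (F : Finset (Sym2 V)) : Prop :=
  SimpleE F ∧ ∀ v : V, degE F v = k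

/-- `F` is the edge set of a single (simple) cycle. -/
def IsCycleE (F : Finset (Sym2 V)) : Prop :=
  ∃ m : ℕ, 3 ≤ m ∧ ∃ f : ℕ → V,
    (∀ i < m, ∀ j < m, f i = f j → i = j) ∧
    F = (Finset.range m).image (fun i => s(f i, f ((i + 1) % m)))

/-- `F` contains no cycle. -/
def AcyclicE (F : Finset (Sym2 V)) : Prop :=
  ∀ C : Finset (Sym2 V), C ⊆ F → ¬ IsCycleE C

/-- `F` is the edge set of a simple path with endpoints `a` and `b`. -/
def IsPathE (F : Finset (Sym2 V)) (a b : V) : Prop :=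
  ∃ m : ℕ, 1 ≤ m ∧ ∃ f : ℕ → V,
    (∀ i ≤ m, ∀ j ≤ m, f i = f j → i = j) ∧ f 0 = a ∧ f m = b ∧
    F = (Finset.range m).image (fun i => s(f i, f (i + 1)))

/-- `P` is a maximal path of `F`, i.e. `P ∈ 𝒫(F)`. -/
def MaxPathE (F P : Finset (Sym2 V)) : Prop :=
  P ⊆ F ∧ (∃ a b : V, IsPathE P a b) ∧
  ∀ e ∈ F, (∃ v : V, v ∈ e ∧ v ∈ VsetE P) → e ∈ P

/-- `F` is a path cover: a spanning acyclic 2-matching. -/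
def IsPathCoverE (F : Finset (Sym2 V)) : Prop :=
  IsKMatching 2 F ∧ SpanningE F ∧ AcyclicE F

/-- `F` is a tour: the edge set of a Hamiltonian cycle. -/
def IsTourE (F : Finset (Sym2 V)) : Prop :=
  IsCycleE F ∧ SpanningE F

/-- Total length of the edge set `F`. -/
def lenE (ℓ : Sym2 V → ℝ) (F : Finset (Sym2 V)) : ℝ := ∑ e ∈ F, ℓ e

/-- Minimum length of a tour. -/
noncomputable def optE (ℓ : Sym2 V → ℝ) : ℝ :=
  sInf {x | ∃ H : Finset (Sym2 V), IsTourE H ∧ lenE ℓ H = x}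

/-- Maximum length of a tour. -/
noncomputable def worE (ℓ : Sym2 V → ℝ) : ℝ :=
  sSup {x | ∃ H : Finset (Sym2 V), IsTourE H ∧ lenE ℓ H = x}

/-- The set of edges of `F` incident to `v`. -/
def deltaE (F : Finset (Sym2 V)) (v : V) : Finset (Sym2 V) :=
  F.filter (fun e => v ∈ e)

/-- `(S, T)` is a valid pair of spanning 2-matchings. -/
def ValidPairE (S T : Finset (Sym2 V)) : Prop :=
  IsKMatching 2 S ∧ IsKMatching 2 T ∧ SpanningE S ∧ SpanningE T ∧
  AcyclicE T ∧
  (∀ v : V, v ∈ V2E S → v ∈ V2E T → deltaE S v = deltaE T v) ∧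
  (∀ C : Finset (Sym2 V), C ⊆ S → IsCycleE C →
    ∀ P : Finset (Sym2 V), MaxPathE T P → VsetE C ≠ VsetE P)

set_option linter.unusedSectionVars false

lemma mem_VsetE {F : Finset (Sym2 V)} {v : V} : v ∈ VsetE F ↔ ∃ e ∈ F, v ∈ e := Iff.rfl

lemma VsetE_union (F G : Finset (Sym2 V)) : VsetE (F ∪ G) = VsetE F ∪ VsetE G := by
  ext v
  simp only [mem_VsetE, Finset.mem_union, Set.mem_union, or_and_right, exists_or]

lemma VsetE_insert (a b : V) (F : Finset (Sym2 V)) :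
    VsetE (insert s(a, b) F) = {a, b} ∪ VsetE F := by
  ext v
  simp [mem_VsetE]

lemma VsetE_singleton (a b : V) : VsetE {s(a, b)} = ({a, b} : Set V) := by
  ext v
  simp [mem_VsetE]

lemma VsetE_mono {F G : Finset (Sym2 V)} (h : F ⊆ G) : VsetE F ⊆ VsetE G :=
  fun _ ⟨e, he, hv⟩ => ⟨e, h he, hv⟩

lemma mem_VsetE_path {m : ℕ} (hm : 1 ≤ m) (f : ℕ → V) {v : V} :
    v ∈ VsetE ((Finset.range m).image (fun i => s(f i, f (i + 1)))) ↔ ∃ i ≤ m, v = f i := by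
  constructor
  · rintro ⟨e, he, hv⟩
    simp only [Finset.mem_image, Finset.mem_range] at he
    obtain ⟨i, hi, rfl⟩ := he
    rcases Sym2.mem_iff.1 hv with h | h
    · exact ⟨i, by omega, h⟩
    · exact ⟨i + 1, by omega, h⟩
  · rintro ⟨i, hi, rfl⟩
    rcases Nat.lt_or_ge i m with h | h
    · exact ⟨_, Finset.mem_image_of_mem _ (Finset.mem_range.2 h), by simp⟩
    · obtain rfl : i = m := by omega
      refine ⟨_, Finset.mem_image_of_mem _ (Finset.mem_range.2 (show i - 1 < i by omega)), ?_⟩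
      simp [Nat.sub_add_cancel hm]

namespace IsPathE

variable {F G : Finset (Sym2 V)} {a b c d v : V}

lemma left_mem (h : IsPathE F a b) : a ∈ VsetE F := by
  obtain ⟨m, hm, f, -, rfl, -, rfl⟩ := h
  exact (mem_VsetE_path hm f).2 ⟨0, by omega, rfl⟩

lemma right_mem (h : IsPathE F a b) : b ∈ VsetE F := by
  obtain ⟨m, hm, f, -, -, rfl, rfl⟩ := h
  exact (mem_VsetE_path hm f).2 ⟨m, le_rfl, rfl⟩

lemma ne (h : IsPathE F a b) : a ≠ b := by
  obtain ⟨m, hm, f, hf, rfl, rfl, -⟩ := h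
  intro h
  have := hf 0 (by omega) m le_rfl h
  omega

lemma symm (h : IsPathE F a b) : IsPathE F b a := by
  obtain ⟨m, hm, f, hf, rfl, rfl, rfl⟩ := h
  refine ⟨m, hm, fun i => f (m - i), ?_, by simp, by simp, ?_⟩
  · intro i hi j hj hij
    have := hf _ (by omega) _ (by omega) hij
    omega
  · ext e
    simp only [Finset.mem_image, Finset.mem_range]
    constructor
    · rintro ⟨i, hi, rfl⟩
      refine ⟨m - 1 - i, by omega, ?_⟩
      rw [show m - (m - 1 - i) = i + 1 by omega, show m - (m - 1 - i + 1) = i by omega,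
        Sym2.eq_swap]
    · rintro ⟨i, hi, rfl⟩
      refine ⟨m - 1 - i, by omega, ?_⟩
      rw [show m - i = m - 1 - i + 1 by omega, show m - (i + 1) = m - 1 - i by omega,
        Sym2.eq_swap]

lemma single (h : a ≠ b) : IsPathE {s(a, b)} a b := by
  refine ⟨1, le_rfl, fun i => if i = 0 then a else b, ?_, by simp, by simp, by simp⟩
  intro i hi j hj hij
  interval_cases i <;> interval_cases j <;> simp_all

lemma glue (hF : IsPathE F a b) (hG : IsPathE G b c)
    (h : ∀ v ∈ VsetE F, v ∈ VsetE G → v = b) : IsPathE (F ∪ G) a c := by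
  obtain ⟨m, hm, f, hf, rfl, hfm, rfl⟩ := hF
  obtain ⟨n, hn, g, hg, hg0, rfl, rfl⟩ := hG
  have key : ∀ i ≤ m, ∀ j ≤ n, f i = g j → i = m ∧ j = 0 := by
    intro i hi j hj hij
    have hb := h (f i) ((mem_VsetE_path hm f).2 ⟨i, hi, rfl⟩)
      ((mem_VsetE_path hn g).2 ⟨j, hj, hij⟩)
    exact ⟨hf _ hi _ le_rfl (hb.trans hfm.symm),
      hg _ hj _ (by omega) (hij.symm.trans (hb.trans hg0.symm))⟩
  refine ⟨m + n, by omega, fun i => if i ≤ m then f i else g (i - m), ?_, by simp, ?_, ?_⟩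
  · intro i hi j hj hij
    by_cases h1 : i ≤ m <;> by_cases h2 : j ≤ m <;> simp only [h1, h2, if_true, if_false] at hij
    · exact hf _ h1 _ h2 hij
    · have := key _ h1 _ (by omega) hij; omega
    · have := key _ h2 _ (by omega) hij.symm; omega
    · have := hg _ (by omega) _ (by omega) hij; omega
  · simp [show ¬ n = 0 by omega]
  · have hg' : ∀ i, m ≤ i → (if i ≤ m then f i else g (i - m)) = g (i - m) := by
      intro i hi
      split_ifs with h'
      · obtain rfl : i = m := by omega
        simp [hfm, hg0]
      · rfl
    ext e
    simp only [Finset.mem_union, Finset.mem_image, Finset.mem_range]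
    constructor
    · rintro (⟨i, hi, rfl⟩ | ⟨i, hi, rfl⟩)
      · exact ⟨i, by omega, by rw [if_pos (by omega), if_pos (by omega)]⟩
      · refine ⟨m + i, by omega, ?_⟩
        rw [hg' _ (by omega), hg' _ (by omega), show m + i - m = i by omega,
          show m + i + 1 - m = i + 1 by omega]
    · rintro ⟨i, hi, rfl⟩
      rcases Nat.lt_or_ge i m with h' | h'
      · exact Or.inl ⟨i, h', by rw [if_pos (by omega), if_pos (by omega)]⟩
      · refine Or.inr ⟨i - m, by omega, ?_⟩
        rw [hg' _ (by omega), hg' _ (by omega), show i + 1 - m = i - m + 1 by omega]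

lemma snoc (hF : IsPathE F a b) (hc : c ∉ VsetE F) : IsPathE (insert s(b, c) F) a c := by
  have hbc : b ≠ c := by
    rintro rfl
    exact hc hF.right_mem
  have := hF.glue (single hbc) (by
    intro v hv hv'
    rw [VsetE_singleton] at hv'
    rcases hv' with rfl | rfl
    · rfl
    · exact absurd hv hc)
  rwa [Finset.union_comm, ← Finset.insert_eq] at this

lemma join (hF : IsPathE F a b) (hG : IsPathE G c d) (h : Disjoint (VsetE F) (VsetE G)) :
    IsPathE (insert s(b, c) (F ∪ G)) a d := by
  have := (hF.snoc (Set.disjoint_right.1 h hG.left_mem)).glue hG (by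
    intro v hv hv'
    rw [VsetE_insert] at hv
    rcases hv with (rfl | rfl) | hv
    · exact absurd hv' (Set.disjoint_left.1 h hF.right_mem)
    · rfl
    · exact absurd hv' (Set.disjoint_left.1 h hv))
  rwa [Finset.insert_union] at this

lemma isCycleE_insert (hF : IsPathE F a b) (h : s(b, a) ∉ F) :
    IsCycleE (insert s(b, a) F) := by
  obtain ⟨m, hm, f, hf, rfl, rfl, rfl⟩ := hF
  have hm2 : 2 ≤ m := by
    by_contra hlt
    obtain rfl : m = 1 := by omega
    exact h (by simp [Sym2.eq_swap])
  refine ⟨m + 1, by omega, f, fun i hi j hj => hf i (by omega) j (by omega), ?_⟩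
  rw [Finset.range_add_one, Finset.image_insert, Nat.mod_self]
  congr 1
  refine Finset.image_congr fun i hi => ?_
  have : i < m := by simpa using hi
  simp only [Nat.mod_eq_of_lt (show i + 1 < m + 1 by omega)]

lemma degE_left (h : IsPathE F a b) : degE F a = 1 := by
  obtain ⟨m, hm, f, hf, rfl, rfl, rfl⟩ := h
  rw [degE, Finset.card_eq_one]
  refine ⟨s(f 0, f 1), ?_⟩
  ext e
  simp only [Finset.mem_filter, Finset.mem_image, Finset.mem_range, Finset.mem_singleton]
  constructor
  · rintro ⟨⟨i, hi, rfl⟩, he⟩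
    rcases Sym2.mem_iff.1 he with h | h
    · obtain rfl := hf _ (by omega) _ (by omega) h
      rfl
    · have := hf _ (by omega) _ (by omega) h
      omega
  · rintro rfl
    exact ⟨⟨0, by omega, rfl⟩, by simp⟩

lemma degE_right (h : IsPathE F a b) : degE F b = 1 := h.symm.degE_left

lemma degE_inner (h : IsPathE F a b) (hv : v ∈ VsetE F) (ha : v ≠ a) (hb : v ≠ b) :
    degE F v = 2 := by
  obtain ⟨m, hm, f, hf, rfl, rfl, rfl⟩ := h
  obtain ⟨i, hi, rfl⟩ := (mem_VsetE_path hm f).1 hv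
  have hi0 : i ≠ 0 := by rintro rfl; exact ha rfl
  have him : i ≠ m := by rintro rfl; exact hb rfl
  obtain ⟨i, rfl⟩ := Nat.exists_eq_succ_of_ne_zero hi0
  rw [degE, Finset.card_eq_two]
  refine ⟨s(f i, f (i + 1)), s(f (i + 1), f (i + 2)), ?_, ?_⟩
  · intro h
    rcases Sym2.eq_iff.1 h with ⟨h, -⟩ | ⟨h, -⟩ <;>
    · have := hf _ (by omega) _ (by omega) h
      omega
  · ext e
    simp only [Finset.mem_filter, Finset.mem_image, Finset.mem_range, Finset.mem_singleton,
      Finset.mem_insert]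
    constructor
    · rintro ⟨⟨j, hj, rfl⟩, he⟩
      rcases Sym2.mem_iff.1 he with h | h
      · obtain rfl := hf _ (by omega) _ (by omega) h
        exact Or.inr rfl
      · have := hf _ (by omega) _ (by omega) h
        obtain rfl : i = j := by omega
        exact Or.inl rfl
    · rintro (rfl | rfl)
      · exact ⟨⟨i, by omega, rfl⟩, by simp⟩
      · exact ⟨⟨i + 1, by omega, rfl⟩, by simp⟩

lemma degE_eq_one_iff (h : IsPathE F a b) (hv : v ∈ VsetE F) :
    degE F v = 1 ↔ v = a ∨ v = b := by
  constructor
  · intro hd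
    by_contra! hne
    have := h.degE_inner hv hne.1 hne.2
    omega
  · rintro (rfl | rfl)
    · exact h.degE_left
    · exact h.degE_right

lemma subset_of_saturated (h : IsPathE F a b)
    (hG : ∀ e ∈ F, (∃ v : V, v ∈ e ∧ v ∈ VsetE G) → e ∈ G)
    (hF : v ∈ VsetE F) (hv : v ∈ VsetE G) : F ⊆ G := by
  obtain ⟨m, hm, f, hf, rfl, rfl, rfl⟩ := h
  have hstep : ∀ j < m, (f j ∈ VsetE G ∨ f (j + 1) ∈ VsetE G) → s(f j, f (j + 1)) ∈ G := by
    intro j hj h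
    refine hG _ (Finset.mem_image_of_mem _ (Finset.mem_range.2 hj)) ?_
    rcases h with h | h
    · exact ⟨_, by simp, h⟩
    · exact ⟨_, by simp, h⟩
  have hall : ∀ j ≤ m, (f j ∈ VsetE G ↔ f 0 ∈ VsetE G) := by
    intro j
    induction j with
    | zero => simp
    | succ j ih =>
      intro hj
      rw [← ih (by omega)]
      exact ⟨fun h => ⟨_, hstep j (by omega) (Or.inr h), by simp⟩,
        fun h => ⟨_, hstep j (by omega) (Or.inl h), by simp⟩⟩
  obtain ⟨i, hi, rfl⟩ := (mem_VsetE_path hm f).1 hF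
  intro e he
  simp only [Finset.mem_image, Finset.mem_range] at he
  obtain ⟨j, hj, rfl⟩ := he
  exact hstep j hj (Or.inl ((hall j (by omega)).2 ((hall i hi).1 hv)))

end IsPathE

lemma MaxPathE.eq_of_mem {S P R : Finset (Sym2 V)} {v : V} (hP : MaxPathE S P)
    (hR : MaxPathE S R) (hvP : v ∈ VsetE P) (hvR : v ∈ VsetE R) : P = R := by
  obtain ⟨hPS, ⟨a, b, hab⟩, hPm⟩ := hP
  obtain ⟨hRS, ⟨c, d, hcd⟩, hRm⟩ := hR
  exact Finset.Subset.antisymm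
    (hab.subset_of_saturated (fun e he => hRm e (hPS he)) hvP hvR)
    (hcd.subset_of_saturated (fun e he => hPm e (hRS he)) hvR hvP)

lemma MaxPathE.degE_eq {S P : Finset (Sym2 V)} {v : V} (hP : MaxPathE S P)
    (hv : v ∈ VsetE P) : degE S v = degE P v := by
  rw [degE, degE]
  congr 1
  ext e
  simp only [Finset.mem_filter]
  exact ⟨fun h => ⟨hP.2.2 e h.1 ⟨v, h.2, hv⟩, h.2⟩, fun h => ⟨hP.1 h.1, h.2⟩⟩

/-- Every edge of an acyclic 2-matching lies on a maximal path. -/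
lemma exists_maxPathE_mem {S : Finset (Sym2 V)} (hS : IsKMatching 2 S) (hac : AcyclicE S)
    {e : Sym2 V} (he : e ∈ S) : ∃ P, MaxPathE S P ∧ e ∈ P := by
  classical
  obtain ⟨P, hP⟩ := Finset.exists_maximal
    (s := S.powerset.filter (fun F => e ∈ F ∧ ∃ a b : V, IsPathE F a b)) (by
      induction e using Sym2.ind with
      | _ a b =>
        refine ⟨{s(a, b)}, ?_⟩
        have hab : a ≠ b := fun h => hS.1 _ he (Sym2.mk_isDiag_iff.2 h)
        simp only [Finset.mem_filter, Finset.mem_powerset, Finset.singleton_subset_iff]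
        exact ⟨he, by simp, a, b, .single hab⟩)
  have hPmem := hP.1
  simp only [Finset.mem_filter, Finset.mem_powerset] at hPmem
  obtain ⟨hPS, heP, hpath⟩ := hPmem
  refine ⟨P, ⟨hPS, hpath, ?_⟩, heP⟩
  intro e' he' ⟨v, hv, hvP⟩
  by_contra hnot
  have hinner : ∀ u ∈ e', u ∈ VsetE P → degE P u ≠ 2 := by
    intro u hu huP hd
    have hsub : P.filter (fun e => u ∈ e) ⊆ S.filter (fun e => u ∈ e) :=
      Finset.filter_subset_filter _ hPS
    have heq := Finset.eq_of_subset_of_card_le hsub ((hS.2 u).trans hd.ge)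
    have hmem : e' ∈ S.filter (fun e => u ∈ e) := Finset.mem_filter.2 ⟨he', hu⟩
    rw [← heq] at hmem
    exact hnot (Finset.mem_filter.1 hmem).1
  obtain ⟨a, hav⟩ : ∃ a, IsPathE P a v := by
    obtain ⟨a, b, hab⟩ := hpath
    by_cases hva : v = a
    · exact ⟨b, hva ▸ hab.symm⟩
    · by_cases hvb : v = b
      · exact ⟨a, hvb ▸ hab⟩
      · exact absurd (hab.degE_inner hvP hva hvb) (hinner v hv hvP)
  obtain ⟨w, rfl⟩ := Sym2.mem_iff_exists.1 hv
  have hvw : v ≠ w := fun h => hS.1 _ he' (Sym2.mk_isDiag_iff.2 h)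
  have hsub : insert s(v, w) P ⊆ S := Finset.insert_subset he' hPS
  by_cases hw : w ∈ VsetE P
  · by_cases hwa : w = a
    · subst hwa
      exact hac _ hsub (hav.isCycleE_insert hnot)
    · exact hinner w (by simp) hw (hav.degE_inner hw hwa hvw.symm)
  · have hmem : insert s(v, w) P ∈
        S.powerset.filter (fun F => e ∈ F ∧ ∃ a b : V, IsPathE F a b) := by
      simp only [Finset.mem_filter, Finset.mem_powerset]
      exact ⟨hsub, Finset.mem_insert_of_mem heP, a, w, hav.snoc hw⟩
    exact hnot (hP.2 hmem (Finset.subset_insert _ _) (Finset.mem_insert_self _ _))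

/-- The edges `(q, x 0), (y 0, x 1), …, (y (n - 1), x n)`. -/
def chainE (n : ℕ) (q : V) (x y : ℕ → V) : Finset (Sym2 V) :=
  insert s(q, x 0) ((Finset.range n).image fun i => s(y i, x (i + 1)))

/-- The edges `(q, x 0), (y 0, x 1), …, (y (n - 1), x n), (y n, p)`. -/
def linkE (n : ℕ) (p q : V) (x y : ℕ → V) : Finset (Sym2 V) :=
  insert s(y n, p) (chainE n q x y)

lemma chainE_succ (n : ℕ) (q : V) (x y : ℕ → V) :
    chainE (n + 1) q x y = insert s(y n, x (n + 1)) (chainE n q x y) := by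
  rw [chainE, chainE, Finset.range_add_one, Finset.image_insert, Finset.insert_comm]

lemma mem_VsetE_chainE {n : ℕ} {q v : V} {x y : ℕ → V} :
    v ∈ VsetE (chainE n q x y) ↔ v = q ∨ (∃ i ≤ n, v = x i) ∨ ∃ i < n, v = y i := by
  induction n with
  | zero => simp [chainE, mem_VsetE]
  | succ n ih =>
    rw [chainE_succ, VsetE_insert, Set.mem_union, ih]
    simp only [Set.mem_insert_iff, Set.mem_singleton_iff, Nat.le_succ_iff, Nat.lt_succ_iff_lt_or_eq,
      or_and_right, exists_or, exists_eq_left]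
    grind

lemma mem_VsetE_linkE {n : ℕ} {p q v : V} {x y : ℕ → V} :
    v ∈ VsetE (linkE n p q x y) ↔ v = p ∨ v = q ∨ ∃ i ≤ n, v = x i ∨ v = y i := by
  rw [linkE, VsetE_insert, Set.mem_union, mem_VsetE_chainE]
  simp only [Set.mem_insert_iff, Set.mem_singleton_iff, Nat.le_iff_lt_or_eq (m := n), or_and_right,
    and_or_left, exists_or, exists_eq_left]
  grind

lemma mem_linkE {n : ℕ} {p q : V} {x y : ℕ → V} {e : Sym2 V} :
    e ∈ linkE n p q x y ↔ e = s(y n, p) ∨ e = s(q, x 0) ∨ ∃ i < n, e = s(y i, x (i + 1)) := by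
  simp only [linkE, chainE, Finset.mem_insert, Finset.mem_image, Finset.mem_range,
    eq_comm (b := e)]

lemma isPathE_chainE {n : ℕ} {q : V} {z : ℕ → V} (hz : ∀ i ≤ n, ∀ j ≤ n, z i = z j → i = j)
    (hq : ∀ i ≤ n, q ≠ z i) : IsPathE (chainE n q z z) q (z n) := by
  induction n with
  | zero => simpa [chainE] using IsPathE.single (hq 0 le_rfl)
  | succ n ih =>
    rw [chainE_succ]
    refine (ih (fun i hi j hj => hz i (by omega) j (by omega)) fun i hi => hq i (by omega)).snoc ?_
    rw [mem_VsetE_chainE]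
    rintro (h | ⟨i, hi, h⟩ | ⟨i, hi, h⟩)
    · exact hq _ le_rfl h.symm
    · have := hz _ le_rfl _ (by omega) h
      omega
    · have := hz _ le_rfl _ (by omega) h
      omega

lemma isPathE_linkE {n : ℕ} {p q : V} {z : ℕ → V} (hz : ∀ i ≤ n, ∀ j ≤ n, z i = z j → i = j)
    (hpq : p ≠ q) (hp : ∀ i ≤ n, p ≠ z i) (hq : ∀ i ≤ n, q ≠ z i) :
    IsPathE (linkE n p q z z) q p := by
  refine (isPathE_chainE hz hq).snoc ?_
  rw [mem_VsetE_chainE]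
  rintro (h | ⟨i, hi, h⟩ | ⟨i, hi, h⟩)
  · exact hpq h
  · exact hp i hi h
  · exact hp i hi.le h

lemma mem_VsetE_union_chainE {n : ℕ} {P : Finset (Sym2 V)} {Q : ℕ → Finset (Sym2 V)} {q : V}
    {x y : ℕ → V} (hq : q ∈ VsetE P) (hx : ∀ i ≤ n, x i ∈ VsetE (Q i))
    (hy : ∀ i ≤ n, y i ∈ VsetE (Q i)) {v : V}
    (hv : v ∈ VsetE (P ∪ (Finset.range (n + 1)).biUnion Q ∪ chainE n q x y)) :
    v ∈ VsetE P ∨ ∃ i ≤ n, v ∈ VsetE (Q i) := by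
  rw [VsetE_union, VsetE_union] at hv
  rcases hv with (hv | ⟨e, he, hv⟩) | hv
  · exact Or.inl hv
  · simp only [Finset.mem_biUnion, Finset.mem_range] at he
    obtain ⟨i, hi, he⟩ := he
    exact Or.inr ⟨i, by omega, e, he, hv⟩
  · rw [mem_VsetE_chainE] at hv
    rcases hv with rfl | ⟨i, hi, rfl⟩ | ⟨i, hi, rfl⟩
    · exact Or.inl hq
    · exact Or.inr ⟨i, hi, hx i hi⟩
    · exact Or.inr ⟨i, hi.le, hy i hi.le⟩

lemma isPathE_union_chainE {n : ℕ} {P : Finset (Sym2 V)} {Q : ℕ → Finset (Sym2 V)} {p q : V}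
    {x y : ℕ → V} (hP : IsPathE P p q) (hQ : ∀ i ≤ n, IsPathE (Q i) (x i) (y i))
    (hQd : ∀ i ≤ n, ∀ j ≤ n, i ≠ j → Disjoint (VsetE (Q i)) (VsetE (Q j)))
    (hPQ : ∀ i ≤ n, Disjoint (VsetE P) (VsetE (Q i))) :
    IsPathE (P ∪ (Finset.range (n + 1)).biUnion Q ∪ chainE n q x y) p (y n) := by
  induction n with
  | zero =>
    have := hP.join (hQ 0 le_rfl) (hPQ 0 le_rfl)
    convert this using 1
    ext e
    simp [chainE]
  | succ n ih =>
    have hQ' : ∀ i ≤ n, IsPathE (Q i) (x i) (y i) := fun i hi => hQ i (by omega)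
    have := (ih hQ' (fun i hi j hj => hQd i (by omega) j (by omega))
      fun i hi => hPQ i (by omega)).join (hQ (n + 1) le_rfl) (by
        refine Set.disjoint_left.2 fun v hv hv' => ?_
        rcases mem_VsetE_union_chainE hP.right_mem (fun i hi => (hQ' i hi).left_mem)
          (fun i hi => (hQ' i hi).right_mem) hv with h | ⟨i, hi, h⟩
        · exact Set.disjoint_left.1 (hPQ _ le_rfl) h hv'
        · exact Set.disjoint_left.1 (hQd i (by omega) _ le_rfl (by omega)) h hv')
    convert this using 1
    rw [chainE_succ, Finset.range_add_one (n := n + 1), Finset.biUnion_insert]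
    ext e
    simp only [Finset.mem_union, Finset.mem_insert]
    tauto

lemma isCycleE_union_linkE {n : ℕ} {P : Finset (Sym2 V)} {Q : ℕ → Finset (Sym2 V)} {p q : V}
    {x y : ℕ → V} (hP : IsPathE P p q) (hQ : ∀ i ≤ n, IsPathE (Q i) (x i) (y i))
    (hQd : ∀ i ≤ n, ∀ j ≤ n, i ≠ j → Disjoint (VsetE (Q i)) (VsetE (Q j)))
    (hPQ : ∀ i ≤ n, Disjoint (VsetE P) (VsetE (Q i))) :
    IsCycleE (P ∪ (Finset.range (n + 1)).biUnion Q ∪ linkE n p q x y) := by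
  have hpQ : ∀ i ≤ n, p ∉ VsetE (Q i) := fun i hi => Set.disjoint_left.1 (hPQ i hi) hP.left_mem
  have hyP : y n ∉ VsetE P := Set.disjoint_right.1 (hPQ n le_rfl) (hQ n le_rfl).right_mem
  rw [linkE, Finset.union_insert]
  refine (isPathE_union_chainE hP hQ hQd hPQ).isCycleE_insert ?_
  simp only [chainE, Finset.mem_union, Finset.mem_biUnion, Finset.mem_range, Finset.mem_insert,
    Finset.mem_image, not_or, not_exists, not_and]
  refine ⟨⟨fun h => hyP ⟨_, h, by simp⟩, fun i hi h => hpQ i (by omega) ⟨_, h, by simp⟩⟩, ?_, ?_⟩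
  · intro h
    rcases Sym2.eq_iff.1 h with ⟨h, -⟩ | ⟨-, h⟩
    · exact hyP (h ▸ hP.right_mem)
    · exact hP.ne h
  · intro i hi h
    have hp : p ∈ s(y i, x (i + 1)) := h ▸ Sym2.mem_mk_right _ _
    rcases Sym2.mem_iff.1 hp with h | h
    · exact hpQ i (by omega) (h ▸ (hQ i (by omega)).right_mem)
    · exact hpQ (i + 1) (by omega) (h ▸ (hQ (i + 1) (by omega)).left_mem)

/-- Linking the maximal paths of a path cover yields a tour. -/
lemma isTourE_union_linkE {n : ℕ} {S P : Finset (Sym2 V)} {Q : ℕ → Finset (Sym2 V)} {p q : V}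
    {x y : ℕ → V} (hS : IsPathCoverE S) (hP : IsPathE P p q)
    (hQ : ∀ i ≤ n, IsPathE (Q i) (x i) (y i))
    (hQd : ∀ i ≤ n, ∀ j ≤ n, i ≠ j → Disjoint (VsetE (Q i)) (VsetE (Q j)))
    (hPQ : ∀ i ≤ n, Disjoint (VsetE P) (VsetE (Q i)))
    (hPS : ∀ R : Finset (Sym2 V), MaxPathE S R ↔ (R = P ∨ ∃ i ≤ n, R = Q i)) :
    IsTourE (S ∪ linkE n p q x y) ∧ VsetE (linkE n p q x y) = V1E S := by
  have hmP : MaxPathE S P := (hPS P).2 (Or.inl rfl)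
  have hmQ : ∀ i ≤ n, MaxPathE S (Q i) := fun i hi => (hPS _).2 (Or.inr ⟨i, hi, rfl⟩)
  have hSeq : S = P ∪ (Finset.range (n + 1)).biUnion Q := by
    ext e
    simp only [Finset.mem_union, Finset.mem_biUnion, Finset.mem_range]
    constructor
    · intro he
      obtain ⟨R, hR, heR⟩ := exists_maxPathE_mem hS.1 hS.2.2 he
      rcases (hPS R).1 hR with rfl | ⟨i, hi, rfl⟩
      · exact Or.inl heR
      · exact Or.inr ⟨i, by omega, heR⟩
    · rintro (h | ⟨i, hi, h⟩)
      · exact hmP.1 h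
      · exact (hmQ i (by omega)).1 h
  refine ⟨⟨?_, ?_⟩, ?_⟩
  · have := isCycleE_union_linkE hP hQ hQd hPQ
    rwa [← hSeq] at this
  · exact Set.univ_subset_iff.1 (hS.2.1.symm.subset.trans (VsetE_mono Finset.subset_union_left))
  · ext v
    rw [mem_VsetE_linkE]
    constructor
    · rintro (rfl | rfl | ⟨i, hi, rfl | rfl⟩)
      · exact (hmP.degE_eq hP.left_mem).trans hP.degE_left
      · exact (hmP.degE_eq hP.right_mem).trans hP.degE_right
      · exact ((hmQ i hi).degE_eq (hQ i hi).left_mem).trans (hQ i hi).degE_left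
      · exact ((hmQ i hi).degE_eq (hQ i hi).right_mem).trans (hQ i hi).degE_right
    · intro hv
      obtain ⟨e, he, hve⟩ : v ∈ VsetE S := hS.2.1.symm.subset (Set.mem_univ v)
      obtain ⟨R, hR, heR⟩ := exists_maxPathE_mem hS.1 hS.2.2 he
      have hvR : v ∈ VsetE R := ⟨e, heR, hve⟩
      have hd : degE R v = 1 := (hR.degE_eq hvR).symm.trans hv
      rcases (hPS R).1 hR with rfl | ⟨i, hi, rfl⟩
      · exact ((hP.degE_eq_one_iff hvR).1 hd).imp_right Or.inl
      · exact Or.inr (Or.inr ⟨i, hi, ((hQ i hi).degE_eq_one_iff hvR).1 hd⟩)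

/-- The two links with interchanged roles of `x` and `y` decompose into the two links that
alternate between `x` and `y`. -/
lemma linkE_union_linkE {n : ℕ} {p1 p2 p3 p4 : V} {x y z w : ℕ → V}
    (hz : ∀ i, z i = if Even i then x i else y i) (hw : ∀ i, w i = if Even i then y i else x i) :
    linkE n p1 p2 x y ∪ linkE n p4 p3 y x =
      linkE n (if Even n then p4 else p1) p2 z z ∪ linkE n (if Even n then p1 else p4) p3 w w := by
  ext e
  simp only [Finset.mem_union, mem_linkE, hz, hw]
  have hmid : (∃ i < n, e = s(y i, x (i + 1))) ∨ (∃ i < n, e = s(x i, y (i + 1))) ↔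
      (∃ i < n, e = s(if Even i then x i else y i, if Even (i + 1) then x (i + 1) else y (i + 1))) ∨
      (∃ i < n, e = s(if Even i then y i else x i, if Even (i + 1) then y (i + 1) else x (i + 1))) := by
    simp only [← exists_or]
    refine exists_congr fun i => ?_
    by_cases hi : Even i <;> simp [hi, Nat.even_add_one]
    exact or_comm
  have h0 : Even 0 := by simp
  have hswap : ∀ a b c d f g : Prop, (a ∨ b ∨ c) ∨ (d ∨ f ∨ g) ↔ a ∨ d ∨ b ∨ f ∨ (c ∨ g) := by
    tauto
  rw [hswap, hswap, hmid]
  by_cases hn : Even n <;> simp only [hn, h0, if_true, if_false]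
  exact or_left_comm

theorem stmt2 (S1 S2 P1 P2 : Finset (Sym2 V)) (k : ℕ)
    (Q : ℕ → Finset (Sym2 V)) (x y : ℕ → V) (p1 p2 p3 p4 : V)
    (hS1 : IsPathCoverE S1) (hS2 : IsPathCoverE S2)
    (hk : 1 ≤ k)
    (hQ : ∀ i < k, IsPathE (Q i) (x i) (y i))
    (hQdisj : ∀ i < k, ∀ j < k, i ≠ j → Disjoint (VsetE (Q i)) (VsetE (Q j)))
    (hP1 : IsPathE P1 p1 p2) (hP2 : IsPathE P2 p3 p4)
    (hVP : VsetE P1 = VsetE P2)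
    (hPS1 : ∀ R : Finset (Sym2 V), MaxPathE S1 R ↔ (R = P1 ∨ ∃ i < k, R = Q i))
    (hPS2 : ∀ R : Finset (Sym2 V), MaxPathE S2 R ↔ (R = P2 ∨ ∃ i < k, R = Q i))
    (hp1 : p1 ≠ p3 ∧ p1 ≠ p4) (hp4 : p4 ≠ p1 ∧ p4 ≠ p2) :
    ∃ A1 A2 : Finset (Sym2 V),
      A1 ∩ A2 = ∅ ∧
      IsTourE (S1 ∪ A1) ∧ IsTourE (S2 ∪ A2) ∧
      VsetE A1 = V1E S1 ∧ VsetE A2 = V1E S2 ∧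
      s(p2, x 0) ∈ A1 ∧ s(p3, y 0) ∈ A2 ∧
      (p2 = p3 → IsPathE (A1 ∪ A2) p1 p4) ∧
      (p2 ≠ p3 → Odd k →
        ∃ R1 R2 : Finset (Sym2 V), IsPathE R1 p1 p3 ∧ IsPathE R2 p2 p4 ∧
          Disjoint (VsetE R1) (VsetE R2) ∧ A1 ∪ A2 = R1 ∪ R2) ∧
      (p2 ≠ p3 → Even k →
        ∃ R1 R2 : Finset (Sym2 V), IsPathE R1 p1 p2 ∧ IsPathE R2 p3 p4 ∧
          Disjoint (VsetE R1) (VsetE R2) ∧ A1 ∪ A2 = R1 ∪ R2) := by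
  obtain ⟨n, rfl⟩ : ∃ n, k = n + 1 := ⟨k - 1, by omega⟩
  simp only [Nat.lt_succ_iff] at hQ hQdisj hPS1 hPS2
  have hPQ1 : ∀ i ≤ n, Disjoint (VsetE P1) (VsetE (Q i)) := by
    refine fun i hi => Set.disjoint_left.2 fun v hv hv' => ?_
    have h1 : P1 = Q i := ((hPS1 _).2 (Or.inl rfl)).eq_of_mem
      ((hPS1 _).2 (Or.inr ⟨i, hi, rfl⟩)) hv hv'
    have h2 : P2 = Q i := ((hPS2 _).2 (Or.inl rfl)).eq_of_mem
      ((hPS2 _).2 (Or.inr ⟨i, hi, rfl⟩)) (hVP ▸ hv) hv'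
    have hP1' : IsPathE P2 p1 p2 := by rwa [h2, ← h1]
    rcases (hP2.degE_eq_one_iff hP1'.left_mem).1 hP1'.degE_left with h | h
    · exact hp1.1 h
    · exact hp1.2 h
  have hPQ2 : ∀ i ≤ n, Disjoint (VsetE P2) (VsetE (Q i)) := by rwa [← hVP]
  obtain ⟨htour1, hV1⟩ := isTourE_union_linkE hS1 hP1 hQ hQdisj hPQ1 hPS1
  obtain ⟨htour2, hV2⟩ := isTourE_union_linkE hS2 hP2.symm (fun i hi => (hQ i hi).symm) hQdisj
    hPQ2 hPS2
  have hinj : ∀ u v : ℕ → V, (∀ i ≤ n, u i ∈ VsetE (Q i)) → (∀ i ≤ n, v i ∈ VsetE (Q i)) →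
      ∀ i ≤ n, ∀ j ≤ n, u i = v j → i = j := by
    intro u v hu hv i hi j hj hij
    by_contra hne
    exact Set.disjoint_left.1 (hQdisj i hi j hj hne) (hu i hi) (hij ▸ hv j hj)
  have hxQ : ∀ i ≤ n, x i ∈ VsetE (Q i) := fun i hi => (hQ i hi).left_mem
  have hyQ : ∀ i ≤ n, y i ∈ VsetE (Q i) := fun i hi => (hQ i hi).right_mem
  have hout : ∀ p ∈ VsetE P1, ∀ u : ℕ → V, (∀ i ≤ n, u i ∈ VsetE (Q i)) → ∀ i ≤ n, p ≠ u i :=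
    fun p hp u hu i hi h => Set.disjoint_left.1 (hPQ1 i hi) hp (h ▸ hu i hi)
  have hm1 := hP1.left_mem
  have hm2 := hP1.right_mem
  have hm3 : p3 ∈ VsetE P1 := hVP ▸ hP2.left_mem
  have hm4 : p4 ∈ VsetE P1 := hVP ▸ hP2.right_mem
  have h12 := hP1.ne
  have h34 := hP2.ne
  obtain ⟨z, hz⟩ : ∃ z : ℕ → V, ∀ i, z i = if Even i then x i else y i := ⟨_, fun _ => rfl⟩
  obtain ⟨w, hw⟩ : ∃ w : ℕ → V, ∀ i, w i = if Even i then y i else x i := ⟨_, fun _ => rfl⟩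
  have hzQ : ∀ i ≤ n, z i ∈ VsetE (Q i) := by
    intro i hi
    rw [hz]
    split_ifs
    exacts [hxQ i hi, hyQ i hi]
  have hwQ : ∀ i ≤ n, w i ∈ VsetE (Q i) := by
    intro i hi
    rw [hw]
    split_ifs
    exacts [hyQ i hi, hxQ i hi]
  have hzw : ∀ i ≤ n, ∀ j ≤ n, z i ≠ w j := by
    intro i hi j hj h
    obtain rfl := hinj z w hzQ hwQ i hi j hj h
    rw [hz, hw] at h
    split_ifs at h
    exacts [(hQ i hi).ne h, (hQ i hi).ne h.symm]
  have hunion := linkE_union_linkE (n := n) (p1 := p1) (p2 := p2) (p3 := p3) (p4 := p4) hz hw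
  have hpathz : ∀ p ∈ VsetE P1, p ≠ p2 → IsPathE (linkE n p p2 z z) p2 p := fun p hp hne =>
    isPathE_linkE (hinj z z hzQ hzQ) hne (hout p hp z hzQ) (hout p2 hm2 z hzQ)
  have hpathw : ∀ p ∈ VsetE P1, p ≠ p3 → IsPathE (linkE n p p3 w w) p3 p := fun p hp hne =>
    isPathE_linkE (hinj w w hwQ hwQ) hne (hout p hp w hwQ) (hout p3 hm3 w hwQ)
  have hmeet : ∀ p ∈ VsetE P1, ∀ q ∈ VsetE P1, p ≠ q → p ≠ p3 → q ≠ p2 →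
      ∀ v ∈ VsetE (linkE n p p2 z z), v ∈ VsetE (linkE n q p3 w w) → v = p2 ∧ v = p3 := by
    intro p hp q hq hpq hp3 hq2 v hv hv'
    simp only [mem_VsetE_linkE, or_self] at hv hv'
    rcases hv with rfl | rfl | ⟨i, hi, rfl⟩ <;> rcases hv' with h | h | ⟨j, hj, h⟩
    · exact absurd h hpq
    · exact absurd h hp3
    · exact absurd h (hout _ hp w hwQ j hj)
    · exact absurd h.symm hq2
    · exact ⟨rfl, h⟩
    · exact absurd h (hout _ hm2 w hwQ j hj)
    · exact absurd h.symm (hout _ hq z hzQ i hi)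
    · exact absurd h.symm (hout _ hm3 z hzQ i hi)
    · exact absurd h (hzw i hi j hj)
  refine ⟨linkE n p1 p2 x y, linkE n p4 p3 y x, ?_, htour1, htour2, hV1, hV2,
    mem_linkE.2 (Or.inr (Or.inl rfl)), mem_linkE.2 (Or.inr (Or.inl rfl)), ?_, ?_, ?_⟩
  · refine Finset.disjoint_iff_inter_eq_empty.1 (Finset.disjoint_left.2 fun e he he' => ?_)
    rw [mem_linkE] at he he'
    have hxy := fun i hi => (hQ i hi).ne
    have hxx := hinj x x hxQ hxQ
    have hyy := hinj y y hyQ hyQ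
    have hxy' := hinj x y hxQ hyQ
    have hx1 := hout p1 hm1 x hxQ
    have hy1 := hout p1 hm1 y hyQ
    have hx2 := hout p2 hm2 x hxQ
    have hy2 := hout p2 hm2 y hyQ
    have hx3 := hout p3 hm3 x hxQ
    have hy3 := hout p3 hm3 y hyQ
    have hx4 := hout p4 hm4 x hxQ
    have hy4 := hout p4 hm4 y hyQ
    rcases he with rfl | rfl | ⟨i, hi, rfl⟩ <;> rcases he' with h | h | ⟨j, hj, h⟩ <;>
      rcases Sym2.eq_iff.1 h with ⟨h, h'⟩ | ⟨h, h'⟩ <;> grind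
  · rintro rfl
    rw [hunion]
    by_cases hn : Even n
    · rw [if_pos hn, if_pos hn, Finset.union_comm]
      exact (hpathw p1 hm1 h12).symm.glue (hpathz p4 hm4 hp4.2) fun v hv hv' =>
        (hmeet p4 hm4 p1 hm1 hp4.1 hp4.2 h12 v hv' hv).1
    · rw [if_neg hn, if_neg hn]
      exact (hpathz p1 hm1 h12).symm.glue (hpathw p4 hm4 hp4.2) fun v hv hv' =>
        (hmeet p1 hm1 p4 hm4 hp1.2 h12 hp4.2 v hv hv').1
  · intro h23 hodd
    have hn : Even n := by
      by_contra hn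
      exact Nat.not_even_iff_odd.2 hodd (Nat.even_add_one.2 hn)
    rw [hunion, if_pos hn, if_pos hn]
    refine ⟨_, _, (hpathw p1 hm1 hp1.1).symm, hpathz p4 hm4 hp4.2, ?_, Finset.union_comm _ _⟩
    refine Set.disjoint_left.2 fun v hv hv' => h23 ?_
    obtain ⟨h, h'⟩ := hmeet p4 hm4 p1 hm1 hp4.1 h34.symm h12 v hv' hv
    exact h.symm.trans h'
  · intro h23 heven
    have hn : ¬ Even n := Nat.even_add_one.1 heven
    rw [hunion, if_neg hn, if_neg hn]
    refine ⟨_, _, (hpathz p1 hm1 h12).symm, hpathw p4 hm4 h34.symm, ?_, rfl⟩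
    refine Set.disjoint_left.2 fun v hv hv' => h23 ?_
    obtain ⟨h, h'⟩ := hmeet p1 hm1 p4 hm4 hp1.2 hp1.1 hp4.2 v hv hv'
    exact h.symm.trans h'
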